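/- Let P ∈ 𝒫ₙ \ {I^{⊗n}} and let Û be the channel representation of R(P). Then exactly 2^{2n−1} of the 4ⁿ diagonal entries of Û equal 1/√2 (and the remaining 2^{2n−1} diagonal entries equal 1). -/

import Mathlib

open Matrix Complex

/-- The four single-qubit Pauli matrices I, X, Y, Z. -/
noncomputable def pauli : Fin 4 → Matrix (Fin 2) (Fin 2) ℂ :=
  ![1, !![0, 1; 1, 0], !![0, -Complex.I; Complex.I, 0], !![1, 0; 0, -1]]

/-- The n-qubit Pauli matrix A₁ ⊗ ⋯ ⊗ Aₙ (Kronecker product realized entrywise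
on the index type `Fin n → Fin 2`). -/
noncomputable def nPauli {n : ℕ} (A : Fin n → Fin 4) :
    Matrix (Fin n → Fin 2) (Fin n → Fin 2) ℂ :=
  fun x y => ∏ j, pauli (A j) (x j) (y j)

/-- R(P) = ½(1+e^{iπ/4})·I + ½(1−e^{iπ/4})·P. -/
noncomputable def RP {n : ℕ} (A : Fin n → Fin 4) :
    Matrix (Fin n → Fin 2) (Fin n → Fin 2) ℂ :=
  ((1 + Complex.exp (Complex.I * Real.pi / 4)) / 2) • 1 +
    ((1 - Complex.exp (Complex.I * Real.pi / 4)) / 2) • nPauli A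

/-- The channel representation: Û_{rs} = (1/2ⁿ)·Tr(P_r U P_s U†). -/
noncomputable def chanRep {n : ℕ} (U : Matrix (Fin n → Fin 2) (Fin n → Fin 2) ℂ) :
    Matrix (Fin n → Fin 4) (Fin n → Fin 4) ℂ :=
  fun r s => (1 / 2 ^ n : ℂ) * (nPauli r * U * nPauli s * Uᴴ).trace

/-- The tensor product of `n` single-qubit matrices. -/
def tensorMatrix {n : ℕ} (M : Fin n → Matrix (Fin 2) (Fin 2) ℂ) :
    Matrix (Fin n → Fin 2) (Fin n → Fin 2) ℂ :=
  fun x y => ∏ j, M j (x j) (y j)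

lemma tensorMatrix_mul {n : ℕ} (M N : Fin n → Matrix (Fin 2) (Fin 2) ℂ) :
    tensorMatrix M * tensorMatrix N = tensorMatrix (fun j => M j * N j) := by
  ext x y
  simp only [tensorMatrix, Matrix.mul_apply, Fintype.prod_sum, Finset.prod_mul_distrib]

lemma trace_tensorMatrix {n : ℕ} (M : Fin n → Matrix (Fin 2) (Fin 2) ℂ) :
    (tensorMatrix M).trace = ∏ j, (M j).trace := by
  simp only [tensorMatrix, Matrix.trace, Matrix.diag, Fintype.prod_sum]

lemma tensorMatrix_one {n : ℕ} :
    tensorMatrix (fun _ : Fin n => (1 : Matrix (Fin 2) (Fin 2) ℂ)) = 1 := by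
  ext x y
  simp only [tensorMatrix, Matrix.one_apply, Finset.prod_ite_zero, Finset.prod_const_one,
    funext_iff, Finset.mem_univ, true_imp_iff]

lemma tensorMatrix_smul {n : ℕ} (c : Fin n → ℂ) (M : Fin n → Matrix (Fin 2) (Fin 2) ℂ) :
    tensorMatrix (fun j => c j • M j) = (∏ j, c j) • tensorMatrix M := by
  ext x y
  simp [tensorMatrix, Finset.prod_mul_distrib]

lemma nPauli_eq_tensorMatrix {n : ℕ} (A : Fin n → Fin 4) :
    nPauli A = tensorMatrix (fun j => pauli (A j)) := rfl

/-- The sign `1` or `-1` according to whether two single-qubit Paulis commute or anticommute. -/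
def pauliSign (a b : Fin 4) : ℤ := if a = 0 ∨ b = 0 ∨ a = b then 1 else -1

lemma pauliSign_eq (a b : Fin 4) : pauliSign a b = 1 ∨ pauliSign a b = -1 := by
  unfold pauliSign; split_ifs <;> simp

lemma sum_pauliSign {b : Fin 4} (hb : b ≠ 0) : ∑ a, pauliSign a b = 0 := by
  revert b; decide

lemma pauli_mul_self (a : Fin 4) : pauli a * pauli a = 1 := by
  fin_cases a <;> ext i j <;> fin_cases i <;> fin_cases j <;> simp [pauli, Matrix.mul_apply]

lemma pauli_conj (a b : Fin 4) :
    pauli a * pauli b * pauli a = (pauliSign a b : ℂ) • pauli b := by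
  fin_cases a <;> fin_cases b <;> ext i j <;> fin_cases i <;> fin_cases j <;>
    simp [pauli, pauliSign, Matrix.mul_apply]

lemma pauli_conjTranspose (a : Fin 4) : (pauli a)ᴴ = pauli a := by
  fin_cases a <;> ext i j <;> fin_cases i <;> fin_cases j <;> simp [pauli]

lemma trace_pauli {a : Fin 4} (ha : a ≠ 0) : (pauli a).trace = 0 := by
  fin_cases a <;> simp_all [pauli, Matrix.trace]

/-- The sign `1` or `-1` according to whether two `n`-qubit Paulis commute or anticommute. -/
def nPauliSign {n : ℕ} (r A : Fin n → Fin 4) : ℤ := ∏ j, pauliSign (r j) (A j)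

lemma nPauliSign_eq {n : ℕ} (r A : Fin n → Fin 4) :
    nPauliSign r A = 1 ∨ nPauliSign r A = -1 := by
  refine Finset.prod_induction _ (fun z : ℤ => z = 1 ∨ z = -1) ?_ (Or.inl rfl)
    (fun j _ => pauliSign_eq _ _)
  rintro _ _ (rfl | rfl) (rfl | rfl) <;> simp

lemma sum_nPauliSign {n : ℕ} {A : Fin n → Fin 4} (hA : A ≠ 0) :
    ∑ r, nPauliSign r A = 0 := by
  obtain ⟨j, hj⟩ := Function.ne_iff.mp hA
  simp only [nPauliSign]
  rw [← Fintype.prod_sum (fun j a => pauliSign a (A j))]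
  exact Finset.prod_eq_zero (Finset.mem_univ j) (sum_pauliSign hj)

lemma nPauli_mul_self {n : ℕ} (A : Fin n → Fin 4) : nPauli A * nPauli A = 1 := by
  simp only [nPauli_eq_tensorMatrix, tensorMatrix_mul, pauli_mul_self, tensorMatrix_one]

lemma nPauli_conj {n : ℕ} (r A : Fin n → Fin 4) :
    nPauli r * nPauli A * nPauli r = (nPauliSign r A : ℂ) • nPauli A := by
  simp only [nPauli_eq_tensorMatrix, tensorMatrix_mul, pauli_conj, tensorMatrix_smul, nPauliSign,
    Int.cast_prod]

lemma nPauli_conjTranspose {n : ℕ} (A : Fin n → Fin 4) : (nPauli A)ᴴ = nPauli A := by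
  ext x y
  simp only [nPauli, Matrix.conjTranspose_apply, star_prod]
  exact Finset.prod_congr rfl fun j _ => congrFun₂ (pauli_conjTranspose (A j)) (x j) (y j)

lemma trace_nPauli {n : ℕ} {A : Fin n → Fin 4} (hA : A ≠ 0) : (nPauli A).trace = 0 := by
  obtain ⟨j, hj⟩ := Function.ne_iff.mp hA
  rw [nPauli_eq_tensorMatrix, trace_tensorMatrix]
  exact Finset.prod_eq_zero (Finset.mem_univ j) (trace_pauli hj)

lemma chanRep_linear_diag {n : ℕ} {A : Fin n → Fin 4} (hA : A ≠ 0) (r : Fin n → Fin 4)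
    (α β : ℂ) :
    chanRep (α • 1 + β • nPauli A) r r = α * star α + nPauliSign r A * (β * star β) := by
  have hconj : nPauli r * (α • 1 + β • nPauli A) * nPauli r =
      α • 1 + (β * nPauliSign r A) • nPauli A := by
    rw [mul_add, add_mul, mul_smul_comm, mul_smul_comm, smul_mul_assoc, smul_mul_assoc, mul_one,
      nPauli_mul_self, nPauli_conj, smul_smul]
  have hpow : (2 : ℂ) ^ n ≠ 0 := pow_ne_zero n two_ne_zero
  simp only [chanRep, hconj]
  simp only [Matrix.conjTranspose_add, Matrix.conjTranspose_smul,
    Matrix.conjTranspose_one, nPauli_conjTranspose, add_mul, mul_add, smul_mul_assoc,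
    mul_smul_comm, mul_one, one_mul, nPauli_mul_self, Matrix.trace_add, Matrix.trace_smul,
    trace_nPauli hA, Matrix.trace_one, smul_eq_mul, mul_zero, Fintype.card_pi, Fintype.card_fin,
    Finset.prod_const, Finset.card_univ, Nat.cast_pow, Nat.cast_ofNat]
  field_simp
  ring

lemma exp_I_mul_pi_div_four :
    Complex.exp (Complex.I * Real.pi / 4) =
      (Real.sqrt 2 : ℂ)⁻¹ + (Real.sqrt 2 : ℂ)⁻¹ * Complex.I := by
  have hsqrt : Real.sqrt 2 / 2 = (Real.sqrt 2)⁻¹ := by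
    rw [Real.sqrt_div_self', one_div]
  have harg : Complex.I * Real.pi / 4 = ((Real.pi / 4 : ℝ) : ℂ) * Complex.I := by
    push_cast; ring
  rw [harg, Complex.exp_mul_I, ← Complex.ofReal_cos, ← Complex.ofReal_sin, Real.cos_pi_div_four,
    Real.sin_pi_div_four, hsqrt, Complex.ofReal_inv]

lemma chanRep_RP_diag {n : ℕ} {A : Fin n → Fin 4} (hA : A ≠ 0) (r : Fin n → Fin 4) :
    chanRep (RP A) r r = if nPauliSign r A = 1 then 1 else (Real.sqrt 2 : ℂ)⁻¹ := by
  have hsq : ((Real.sqrt 2 : ℂ)⁻¹) ^ 2 = 1 / 2 := by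
    rw [inv_pow, ← Complex.ofReal_pow, Real.sq_sqrt zero_le_two]; norm_num
  rw [RP, chanRep_linear_diag hA, exp_I_mul_pi_div_four]
  simp only [Complex.star_def, map_div₀, map_add, map_sub, map_mul, map_one, map_inv₀,
    Complex.conj_ofReal, Complex.conj_I, map_ofNat]
  generalize (Real.sqrt 2 : ℂ)⁻¹ = t at hsq ⊢
  rcases nPauliSign_eq r A with h | h
  · simp only [h, if_true]
    push_cast
    linear_combination hsq - t ^ 2 / 2 * Complex.I_sq
  · simp only [h]
    norm_num
    ring

lemma inv_sqrt_two_ne_one : (Real.sqrt 2 : ℂ)⁻¹ ≠ 1 := by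
  norm_cast
  rw [inv_eq_one, Real.sqrt_eq_one]
  norm_num

lemma card_nPauliSign {n : ℕ} {A : Fin n → Fin 4} (hA : A ≠ 0) :
    Nat.card {r // ¬ nPauliSign r A = 1} = 2 ^ (2 * n - 1) ∧
      Nat.card {r // nPauliSign r A = 1} = 2 ^ (2 * n - 1) := by
  have hn : n ≠ 0 := by
    rintro rfl
    exact hA (Subsingleton.elim _ _)
  have htotal := Finset.card_filter_add_card_filter_not (s := Finset.univ)
    (fun r : Fin n → Fin 4 => nPauliSign r A = 1)
  have hcard : (Finset.univ : Finset (Fin n → Fin 4)).card = 2 * 2 ^ (2 * n - 1) := by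
    rw [← pow_succ', Nat.sub_add_cancel (by lia), pow_mul]
    simp
  have hsum := sum_nPauliSign hA
  have hsign : ∀ r, nPauliSign r A =
      (if nPauliSign r A = 1 then 1 else 0) - (if ¬ nPauliSign r A = 1 then 1 else 0) := by
    intro r
    rcases nPauliSign_eq r A with h | h <;> simp [h]
  rw [Finset.sum_congr rfl fun r _ => hsign r, Finset.sum_sub_distrib, Finset.sum_boole,
    Finset.sum_boole] at hsum
  simp only [Nat.card_eq_fintype_card, Fintype.card_subtype]
  lia

/-- exactly 2^{2n−1} diagonal entries of Û equal 1/√2, and the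
remaining 2^{2n−1} diagonal entries equal 1. -/
theorem chanRep_diag_count {n : ℕ} (A : Fin n → Fin 4) (hA : A ≠ 0) :
    Nat.card {r : Fin n → Fin 4 // chanRep (RP A) r r = (Real.sqrt 2 : ℂ)⁻¹} = 2 ^ (2 * n - 1) ∧
      Nat.card {r : Fin n → Fin 4 // chanRep (RP A) r r = 1} = 2 ^ (2 * n - 1) := by
  have hne := inv_sqrt_two_ne_one
  have hsqrt (r : Fin n → Fin 4) :
      chanRep (RP A) r r = (Real.sqrt 2 : ℂ)⁻¹ ↔ ¬ nPauliSign r A = 1 := by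
    rw [chanRep_RP_diag hA]
    split_ifs with h <;> simp [h, hne.symm]
  have hone (r : Fin n → Fin 4) : chanRep (RP A) r r = 1 ↔ nPauliSign r A = 1 := by
    rw [chanRep_RP_diag hA]
    split_ifs with h
    · simp [h]
    · simpa only [h, iff_false] using hne
  rw [Nat.card_congr (Equiv.subtypeEquivRight hsqrt), Nat.card_congr (Equiv.subtypeEquivRight hone)]
  exact card_nPauliSign hA
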